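/- For all f, g ∈ Δ, the maximal domain of the Jacobi expression ℓ[·] in L²((-1,1); (1-x²)^{-1}dx), Dirichlet's formula holds with vanishing boundary terms: ∫_{-1}^{1} ℓ[f](x)·ḡ(x)·(1-x²)^{-1}dx = ∫_{-1}^{1} [f'(x)ḡ'(x) + k(1-x²)^{-1}f(x)ḡ(x)] dx. In particular, ∫_{-1}^{1} ℓ[f](x)·f̄(x)·(1-x²)^{-1}dx ≥ k·∫_{-1}^{1} |f(x)|²(1-x²)^{-1}dx, i.e., the maximal operator is bounded below by k times the identity. -/

import Mathlib

open MeasureTheory Set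

/-- Membership in the maximal domain `Δ` of the Jacobi expression
`ℓ[y](x) = -(1-x²)y''(x) + k·y(x)` in `L²((-1,1); (1-x²)⁻¹ dx)`. -/
def InJacobiMaxDomain (k : ℝ) (f f' f'' : ℝ → ℂ) : Prop :=
  (∀ x ∈ Ioo (-1 : ℝ) 1, ∀ y ∈ Ioo (-1 : ℝ) 1, IntervalIntegrable f' volume x y) ∧
  (∀ x ∈ Ioo (-1 : ℝ) 1, ∀ y ∈ Ioo (-1 : ℝ) 1, IntervalIntegrable f'' volume x y) ∧
  (∀ x ∈ Ioo (-1 : ℝ) 1, ∀ y ∈ Ioo (-1 : ℝ) 1, f y - f x = ∫ t in x..y, f' t) ∧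
  (∀ x ∈ Ioo (-1 : ℝ) 1, ∀ y ∈ Ioo (-1 : ℝ) 1, f' y - f' x = ∫ t in x..y, f'' t) ∧
  IntegrableOn (fun x => ‖f x‖ ^ 2 * (1 - x ^ 2)⁻¹) (Ioo (-1 : ℝ) 1) ∧
  IntegrableOn
    (fun x => ‖-((1 - x ^ 2 : ℝ) : ℂ) * f'' x + (k : ℂ) * f x‖ ^ 2 * (1 - x ^ 2)⁻¹)
    (Ioo (-1 : ℝ) 1)


open Filter Topology

lemma ac_primitive {u : ℝ → ℂ} {a b : ℝ} (h : IntervalIntegrable u volume a b) :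
    AbsolutelyContinuousOnInterval (fun x => ∫ t in a..x, u t) a b := by
  have hN := h.norm.absolutelyContinuousOnInterval_intervalIntegral (c := a) (by simp)
  unfold AbsolutelyContinuousOnInterval at hN ⊢
  refine squeeze_zero' ?_ ?_ hN
  · filter_upwards with E
    exact Finset.sum_nonneg (fun _ _ => dist_nonneg)
  have : ∀ᶠ (E : ℕ × (ℕ → ℝ × ℝ)) in
      AbsolutelyContinuousOnInterval.totalLengthFilter ⊓
        𝓟 (AbsolutelyContinuousOnInterval.disjWithin a b),
      E ∈ AbsolutelyContinuousOnInterval.disjWithin a b :=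
    eventually_inf_principal.mpr (by simp)
  filter_upwards [this] with E hE
  obtain ⟨h1, h2⟩ := hE
  refine Finset.sum_le_sum (fun i hi => ?_)
  obtain ⟨h3, h4⟩ := h1 i hi
  have ha : a ∈ uIcc a b := left_mem_uIcc
  have i1 : IntervalIntegrable u volume a (E.2 i).1 :=
    h.mono_set (uIcc_subset_uIcc ha h3)
  have i2 : IntervalIntegrable u volume a (E.2 i).2 :=
    h.mono_set (uIcc_subset_uIcc ha h4)
  rw [dist_eq_norm, dist_eq_norm, intervalIntegral.integral_interval_sub_left i1 i2,
    intervalIntegral.integral_interval_sub_left i1.norm i2.norm]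
  exact intervalIntegral.norm_integral_le_abs_integral_norm

lemma ibp_aux {u v : ℝ → ℂ} {a b : ℝ} (c d : ℂ) (hu : IntervalIntegrable u volume a b)
    (hv : IntervalIntegrable v volume a b) :
    ∫ x in a..b, (u x * (d + ∫ t in a..x, v t) + (c + ∫ t in a..x, u t) * v x) =
      (c + ∫ t in a..b, u t) * (d + ∫ t in a..b, v t) - c * d := by
  have hconst : ∀ c : ℂ, AbsolutelyContinuousOnInterval (fun _ : ℝ => c) a b := by
    intro c; simpa [AbsolutelyContinuousOnInterval] using tendsto_const_nhds
  have hU : AbsolutelyContinuousOnInterval (fun x => c + ∫ t in a..x, u t) a b :=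
    (hconst c).add (ac_primitive hu)
  have hV : AbsolutelyContinuousOnInterval (fun x => d + ∫ t in a..x, v t) a b :=
    (hconst d).add (ac_primitive hv)
  have hI : IntervalIntegrable
      (fun x => u x * (d + ∫ t in a..x, v t) + (c + ∫ t in a..x, u t) * v x) volume a b :=
    (hu.mul_continuousOn hV.continuousOn).add (hv.continuousOn_mul hU.continuousOn)
  have hW := ac_primitive hI
  have hD := (hU.fun_smul hV).fun_sub hW
  obtain ⟨C, hC⟩ := hD.const_of_ae_hasDerivAt_zero (by
    filter_upwards [hu.ae_hasDerivAt_integral, hv.ae_hasDerivAt_integral,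
      hI.ae_hasDerivAt_integral] with x h1 h2 h3 hx
    have e1 := (h1 hx a left_mem_uIcc).const_add c
    have e2 := (h2 hx a left_mem_uIcc).const_add d
    have e3 := h3 hx a left_mem_uIcc
    have := (e1.mul e2).sub e3
    simp only [sub_self] at this
    exact this)
  have e1 := hC a left_mem_uIcc
  have e2 := hC b right_mem_uIcc
  simp only [intervalIntegral.integral_same, smul_eq_mul] at e1 e2
  linear_combination e1 - e2

lemma ibp {U V u v : ℝ → ℂ} {a b : ℝ} (hu : IntervalIntegrable u volume a b)
    (hv : IntervalIntegrable v volume a b)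
    (hU : ∀ x ∈ uIcc a b, U x - U a = ∫ t in a..x, u t)
    (hV : ∀ x ∈ uIcc a b, V x - V a = ∫ t in a..x, v t) :
    ∫ x in a..b, (u x * V x + U x * v x) = U b * V b - U a * V a := by
  have := ibp_aux (U a) (V a) hu hv
  rw [← hU b right_mem_uIcc, ← hV b right_mem_uIcc] at this
  simp only [add_sub_cancel] at this
  rw [← this]
  apply intervalIntegral.integral_congr
  intro x hx
  simp only
  rw [← hU x hx, ← hV x hx]
  ring

lemma pow_integral (r : ℝ) (hr : r ≠ 0) {x y : ℝ} (hxy : x ≤ y) (hy : y < 1) :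
    IntervalIntegrable (fun t : ℝ => (1 - t) ^ (r - 1)) volume x y ∧
    ∫ t in x..y, (1 - t) ^ (r - 1) = ((1 - x) ^ r - (1 - y) ^ r) / r := by
  have hpos : ∀ t ∈ uIcc x y, 0 < 1 - t := by
    intro t ht
    rw [uIcc_of_le hxy] at ht
    linarith [ht.2]
  have hI : IntervalIntegrable (fun t : ℝ => (1 - t) ^ (r - 1)) volume x y := by
    apply ContinuousOn.intervalIntegrable
    apply ContinuousOn.rpow_const (by fun_prop)
    intro t ht
    exact Or.inl (hpos t ht).ne'
  refine ⟨hI, ?_⟩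
  rw [intervalIntegral.integral_eq_sub_of_hasDerivAt (f := fun t => -((1 - t) ^ r / r)) _ hI]
  · ring
  · intro t ht
    have h1 : HasDerivAt (fun t : ℝ => 1 - t) (-1) t := by
      simpa using (hasDerivAt_id t).const_sub 1
    have h2 := ((h1.rpow_const (p := r) (Or.inl (hpos t ht).ne')).div_const r).neg
    convert h2 using 1
    · rfl
    · field_simp

lemma deriv_bound_right {k : ℝ} {f f' f'' : ℝ → ℂ} (hf : InJacobiMaxDomain k f f' f'') :
    ∃ C : ℝ, 0 ≤ C ∧ ∀ x ∈ Ico (0 : ℝ) 1, ‖f' x‖ ≤ C * (1 - x) ^ (-(1 / 4) : ℝ) := by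
  obtain ⟨-, h2, -, h4, h5, h6⟩ := hf
  set P : ℝ → ℝ := fun x => k ^ 2 * (‖f x‖ ^ 2 * (1 - x ^ 2)⁻¹) +
    ‖-((1 - x ^ 2 : ℝ) : ℂ) * f'' x + (k : ℂ) * f x‖ ^ 2 * (1 - x ^ 2)⁻¹ with hP
  have hPI : IntegrableOn P (Ioo (-1 : ℝ) 1) := (h5.const_mul (k ^ 2)).add h6
  have hw : ∀ x ∈ Ioo (-1 : ℝ) 1, 0 < 1 - x ^ 2 := by
    intro x hx; nlinarith [hx.1, hx.2]
  have hP0 : ∀ x ∈ Ioo (-1 : ℝ) 1, 0 ≤ P x := by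
    intro x hx
    have := hw x hx
    simp only [hP]; positivity
  set M := ∫ x in Ioo (-1 : ℝ) 1, P x with hM
  have hM0 : 0 ≤ M := setIntegral_nonneg measurableSet_Ioo hP0
  refine ⟨‖f' 0‖ + M + 4, by positivity, ?_⟩
  intro x hx
  have hsub : Ioc 0 x ⊆ Ioo (-1 : ℝ) 1 := fun t ht => ⟨by linarith [ht.1], by linarith [ht.2, hx.2]⟩
  have hx1 : x ∈ Ioo (-1 : ℝ) 1 := ⟨by linarith [hx.1], hx.2⟩
  have h01 : (0 : ℝ) ∈ Ioo (-1 : ℝ) 1 := by norm_num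
  obtain ⟨hI, hE⟩ := pow_integral (-(1/4)) (by norm_num) hx.1 hx.2
  have hPi : IntervalIntegrable P volume 0 x := by
    rw [intervalIntegrable_iff_integrableOn_Ioc_of_le hx.1]
    exact hPI.mono_set hsub
  have key : ‖∫ t in (0 : ℝ)..x, f'' t‖ ≤ ∫ t in (0 : ℝ)..x, (P t + (1 - t) ^ (-(1/4) - 1 : ℝ)) := by
    apply intervalIntegral.norm_integral_le_of_norm_le hx.1 _ (hPi.add hI)
    filter_upwards with t ht
    have ht' := hsub ht
    have hwt := hw t ht'
    have e1 : ‖f'' t‖ = ‖((1 - t ^ 2 : ℝ) : ℂ) * f'' t‖ * (1 - t ^ 2)⁻¹ := by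
      rw [norm_mul, Complex.norm_real, Real.norm_of_nonneg hwt.le]
      field_simp
    have e2 : ‖((1 - t ^ 2 : ℝ) : ℂ) * f'' t‖ ≤ ‖(k : ℂ) * f t‖ +
        ‖-((1 - t ^ 2 : ℝ) : ℂ) * f'' t + (k : ℂ) * f t‖ := by
      refine le_trans (le_of_eq ?_) (norm_sub_le _ _)
      congr 1; ring
    have e3 : ‖(k : ℂ) * f t‖ ^ 2 = k ^ 2 * ‖f t‖ ^ 2 := by
      rw [norm_mul, Complex.norm_real, mul_pow, Real.norm_eq_abs, sq_abs]
    have e4 : (1 - t ^ 2)⁻¹ ≤ (1 - t) ^ (-(1/4) - 1 : ℝ) := by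
      have a1 : 0 < 1 - t := by linarith [ht'.2]
      have a2 : (1 - t ^ 2)⁻¹ ≤ (1 - t)⁻¹ := by
        apply inv_anti₀ a1
        nlinarith [ht.1, ht'.2]
      refine a2.trans ?_
      rw [← Real.rpow_neg_one]
      exact Real.rpow_le_rpow_of_exponent_ge a1 (by linarith [ht.1]) (by norm_num)
    set p := ‖((1 - t ^ 2 : ℝ) : ℂ) * f'' t‖
    set q := ‖-((1 - t ^ 2 : ℝ) : ℂ) * f'' t + (k : ℂ) * f t‖ with hq
    have e5 : p ≤ k ^ 2 * ‖f t‖ ^ 2 + q ^ 2 + 1 := by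
      rw [← e3]
      nlinarith [sq_nonneg (‖(k : ℂ) * f t‖ - 1/2), sq_nonneg (q - 1/2)]
    rw [e1]
    have e6 : P t = (k ^ 2 * ‖f t‖ ^ 2 + q ^ 2) * (1 - t ^ 2)⁻¹ := by
      simp only [hP, hq]; ring
    rw [e6]
    have := mul_le_mul_of_nonneg_right e5 (inv_nonneg.2 hwt.le)
    linarith
  rw [intervalIntegral.integral_add hPi hI, hE] at key
  have k2 : ∫ t in (0 : ℝ)..x, P t ≤ M := by
    rw [intervalIntegral.integral_of_le hx.1]
    apply setIntegral_mono_set hPI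
    · filter_upwards [ae_restrict_mem measurableSet_Ioo] with t ht using hP0 t ht
    · exact hsub.eventuallyLE
  have k3 : ‖f' x‖ ≤ ‖f' 0‖ + ‖∫ t in (0 : ℝ)..x, f'' t‖ := by
    rw [← h4 0 h01 x hx1]
    refine le_trans (le_of_eq ?_) (norm_add_le _ _)
    congr 1; ring
  have k4 : 1 ≤ (1 - x) ^ (-(1 / 4) : ℝ) :=
    Real.one_le_rpow_of_pos_of_le_one_of_nonpos (by linarith [hx.2]) (by linarith [hx.1])
      (by norm_num)
  have k5 : ((1 - (0:ℝ)) ^ (-(1/4) : ℝ) - (1 - x) ^ (-(1/4) : ℝ)) / (-(1/4) : ℝ) =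
      4 * (1 - x) ^ (-(1/4) : ℝ) - 4 := by
    simp; ring
  rw [k5] at key
  nlinarith [norm_nonneg (f' 0)]

lemma bound_right {k : ℝ} {f f' f'' : ℝ → ℂ} (hf : InJacobiMaxDomain k f f' f'') :
    ∃ C : ℝ, 0 ≤ C ∧ ∀ x ∈ Ico (0 : ℝ) 1, ‖f x‖ ≤ C * (1 - x) ^ (3 / 4 : ℝ) := by
  obtain ⟨C, hC, hb⟩ := deriv_bound_right hf
  obtain ⟨-, -, h3, -, h5, -⟩ := hf
  refine ⟨C * (4 / 3), by positivity, ?_⟩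
  intro x hx
  by_contra! hcon
  set δ := ‖f x‖ - C * (4 / 3) * (1 - x) ^ (3 / 4 : ℝ) with hδ
  have hδ0 : 0 < δ := by linarith
  have hx1 : x ∈ Ioo (-1 : ℝ) 1 := ⟨by linarith [hx.1], hx.2⟩
  have hlow : ∀ y ∈ Ioo x 1, δ ≤ ‖f y‖ := by
    intro y hy
    have hy1 : y ∈ Ioo (-1 : ℝ) 1 := ⟨by linarith [hx.1, hy.1], hy.2⟩
    obtain ⟨hI, hE⟩ := pow_integral (3/4) (by norm_num) hy.1.le hy.2
    have key : ‖∫ t in x..y, f' t‖ ≤ ∫ t in x..y, C * (1 - t) ^ (3/4 - 1 : ℝ) := by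
      apply intervalIntegral.norm_integral_le_of_norm_le hy.1.le _ (hI.const_mul C)
      filter_upwards with t ht
      have := hb t ⟨by linarith [hx.1, ht.1], by linarith [ht.2, hy.2]⟩
      convert this using 3
      norm_num
    rw [intervalIntegral.integral_const_mul, hE, ← h3 x hx1 y hy1] at key
    have h7 : ‖f x‖ ≤ ‖f y‖ + ‖f y - f x‖ := by
      refine le_trans (le_of_eq ?_) (norm_sub_le _ _)
      congr 1; ring
    have h8 : 0 ≤ C * (1 - y) ^ (3 / 4 : ℝ) :=
      mul_nonneg hC (Real.rpow_nonneg (by linarith [hy.2]) _)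
    linarith
  have hnot : ¬ IntervalIntegrable (fun t : ℝ => (t - 1)⁻¹) volume x 1 := by
    rw [intervalIntegrable_sub_inv_iff]
    simp [hx.2.ne]
  apply hnot
  rw [intervalIntegrable_iff_integrableOn_Ioo_of_le hx.2.le]
  have h9 : IntegrableOn (fun t => (2 / δ ^ 2) * (‖f t‖ ^ 2 * (1 - t ^ 2)⁻¹)) (Ioo x 1) :=
    (h5.mono_set (fun t ht => ⟨by linarith [hx.1, ht.1], ht.2⟩)).const_mul _
  refine Integrable.mono' h9 (by fun_prop) ?_
  filter_upwards [ae_restrict_mem measurableSet_Ioo] with t ht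
  have t1 : 0 < 1 - t := by linarith [ht.2]
  have t2 : 0 < 1 + t := by linarith [ht.1, hx.1]
  have t3 : 1 - t ^ 2 = (1 - t) * (1 + t) := by ring
  have t4 : ‖(t - 1)⁻¹‖ = (1 - t)⁻¹ := by
    rw [norm_inv, Real.norm_eq_abs, abs_sub_comm, abs_of_pos t1]
  have t5 : δ ^ 2 ≤ ‖f t‖ ^ 2 := by
    have := hlow t ht
    gcongr
  rw [t4, t3]
  have : (2 / δ ^ 2) * (‖f t‖ ^ 2 * ((1 - t) * (1 + t))⁻¹) =
    (1 - t)⁻¹ * ((‖f t‖ ^ 2 / δ ^ 2) * (2 / (1 + t))) := by field_simp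
  rw [this]
  have u1 : 1 ≤ ‖f t‖ ^ 2 / δ ^ 2 := by rwa [one_le_div (by positivity)]
  have u2 : 1 ≤ 2 / (1 + t) := by rw [one_le_div t2]; linarith [ht.2]
  exact le_mul_of_one_le_right (inv_pos.2 t1).le (one_le_mul_of_one_le_of_one_le u1 u2)

lemma reflect {k : ℝ} {f f' f'' : ℝ → ℂ} (hf : InJacobiMaxDomain k f f' f'') :
    InJacobiMaxDomain k (fun x => f (-x)) (fun x => -f' (-x)) (fun x => f'' (-x)) := by
  obtain ⟨h1, h2, h3, h4, h5, h6⟩ := hf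
  have hneg : ∀ x ∈ Ioo (-1 : ℝ) 1, -x ∈ Ioo (-1 : ℝ) 1 := fun x hx =>
    ⟨by linarith [hx.2], by linarith [hx.1]⟩
  have hint : ∀ u : ℝ → ℝ, IntegrableOn u (Ioo (-1 : ℝ) 1) →
      IntegrableOn (fun x => u (-x)) (Ioo (-1 : ℝ) 1) := by
    intro u hu
    have := hu.comp_neg
    simpa using this
  have hii : ∀ u : ℝ → ℂ, ∀ x y, IntervalIntegrable u volume (-x) (-y) →
      IntervalIntegrable (fun x => u (-x)) volume x y := by
    intro u x y hu
    simpa using (IntervalIntegrable.iff_comp_neg (by simp)).1 hu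
  refine ⟨fun x hx y hy => (hii f' x y (h1 _ (hneg x hx) _ (hneg y hy))).neg,
    fun x hx y hy => hii f'' x y (h2 _ (hneg x hx) _ (hneg y hy)), ?_, ?_, ?_, ?_⟩
  · intro x hx y hy
    rw [intervalIntegral.integral_neg, intervalIntegral.integral_comp_neg,
      ← h3 _ (hneg y hy) _ (hneg x hx)]
    ring
  · intro x hx y hy
    rw [intervalIntegral.integral_comp_neg, ← h4 _ (hneg y hy) _ (hneg x hx)]
    ring
  · simpa using hint _ h5
  · simpa using hint _ h6

lemma bounds {k : ℝ} {f f' f'' : ℝ → ℂ} (hf : InJacobiMaxDomain k f f' f'') :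
    ∃ C : ℝ, 0 ≤ C ∧ ∀ x ∈ Ioo (-1 : ℝ) 1, ‖f' x‖ ≤ C * (1 - |x|) ^ (-(1 / 4) : ℝ) ∧
      ‖f x‖ ≤ C * (1 - |x|) ^ (3 / 4 : ℝ) := by
  obtain ⟨A, hA, h1⟩ := deriv_bound_right hf
  obtain ⟨B, hB, h2⟩ := bound_right hf
  obtain ⟨A', hA', h1'⟩ := deriv_bound_right (reflect hf)
  obtain ⟨B', hB', h2'⟩ := bound_right (reflect hf)
  refine ⟨A + B + A' + B', by positivity, fun x hx => ?_⟩
  have hab : |x| < 1 := abs_lt.2 hx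
  have p1 : 0 ≤ (1 - |x|) ^ (-(1 / 4) : ℝ) := Real.rpow_nonneg (by linarith) _
  have p2 : 0 ≤ (1 - |x|) ^ (3 / 4 : ℝ) := Real.rpow_nonneg (by linarith) _
  rcases le_total 0 x with h | h
  · rw [abs_of_nonneg h] at *
    have a := h1 x ⟨h, hx.2⟩
    have b := h2 x ⟨h, hx.2⟩
    constructor
    · refine a.trans (mul_le_mul_of_nonneg_right (by linarith) p1)
    · refine b.trans (mul_le_mul_of_nonneg_right (by linarith) p2)
  · rw [abs_of_nonpos h] at *
    have a := h1' (-x) ⟨by linarith, hab⟩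
    have b := h2' (-x) ⟨by linarith, hab⟩
    simp only [neg_neg, norm_neg] at a b
    constructor
    · refine a.trans (mul_le_mul_of_nonneg_right (by linarith) p1)
    · refine b.trans (mul_le_mul_of_nonneg_right (by linarith) p2)

lemma pow_integrableOn :
    IntegrableOn (fun x : ℝ => (1 - |x|) ^ (-(1 / 2) : ℝ)) (Ioo (-1 : ℝ) 1) := by
  have h0 : ∀ a b : ℝ, IntervalIntegrable (fun x : ℝ => x ^ (-(1 / 2) : ℝ)) volume a b :=
    fun a b => intervalIntegral.intervalIntegrable_rpow' (by norm_num)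
  have h1 : IntegrableOn (fun x : ℝ => (1 - x) ^ (-(1 / 2) : ℝ)) (Ioo (-1 : ℝ) 1) := by
    rw [← intervalIntegrable_iff_integrableOn_Ioo_of_le (by norm_num)]
    have := (h0 2 0).comp_sub_left 1
    norm_num at this ⊢
    exact this
  have h2 : IntegrableOn (fun x : ℝ => (1 + x) ^ (-(1 / 2) : ℝ)) (Ioo (-1 : ℝ) 1) := by
    rw [← intervalIntegrable_iff_integrableOn_Ioo_of_le (by norm_num)]
    have := (h0 0 2).comp_add_left 1
    norm_num at this ⊢
    exact this
  refine Integrable.mono' (h1.add h2) (Measurable.aestronglyMeasurable (by fun_prop)) ?_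
  filter_upwards [ae_restrict_mem measurableSet_Ioo] with x hx
  have p1 : 0 ≤ (1 - x) ^ (-(1 / 2) : ℝ) := Real.rpow_nonneg (by linarith [hx.2]) _
  have p2 : 0 ≤ (1 + x) ^ (-(1 / 2) : ℝ) := Real.rpow_nonneg (by linarith [hx.1]) _
  have hab : |x| < 1 := abs_lt.2 hx
  rw [Real.norm_of_nonneg (Real.rpow_nonneg (by linarith) _)]
  simp only [Pi.add_apply]
  rcases le_total 0 x with h | h
  · rw [abs_of_nonneg h]; linarith
  · rw [abs_of_nonpos h, sub_neg_eq_add]; linarith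

/-- The exhausting sequence of right endpoints. -/
noncomputable def exhSeq (n : ℕ) : ℝ := 1 - 1 / ((n : ℝ) + 1) / 2

lemma exhSeq_tendsto : Tendsto exhSeq atTop (𝓝 1) := by
  have := (tendsto_one_div_add_atTop_nhds_zero_nat (𝕜 := ℝ)).div_const 2
  have h2 := this.const_sub 1
  rw [zero_div, sub_zero] at h2
  exact h2

lemma exhSeq_mem (n : ℕ) : exhSeq n ∈ Ico (0 : ℝ) 1 := by
  have h1 : 0 < 1 / ((n : ℝ) + 1) := by positivity
  have h2 : 1 / ((n : ℝ) + 1) ≤ 1 := by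
    rw [div_le_one (by positivity)]; linarith [(Nat.cast_nonneg n : (0 : ℝ) ≤ n)]
  unfold exhSeq
  constructor <;> linarith

lemma exhSeq_cover : AECover (volume.restrict (Ioo (-1 : ℝ) 1)) atTop
    (fun n => Ioc (-exhSeq n) (exhSeq n)) :=
  aecover_Ioo_of_Ioc exhSeq_tendsto.neg exhSeq_tendsto

lemma meas_of_loc {u : ℝ → ℂ}
    (h : ∀ x ∈ Ioo (-1 : ℝ) 1, ∀ y ∈ Ioo (-1 : ℝ) 1, IntervalIntegrable u volume x y) :
    AEStronglyMeasurable u (volume.restrict (Ioo (-1 : ℝ) 1)) := by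
  refine exhSeq_cover.aestronglyMeasurable (fun n => ?_)
  obtain ⟨h0, h1⟩ := exhSeq_mem n
  have := h (-exhSeq n) ⟨by linarith, by linarith⟩ (exhSeq n) ⟨by linarith, h1⟩
  exact (this.1.aestronglyMeasurable).mono_measure
    (Measure.restrict_mono_measure Measure.restrict_le_self _)

lemma loc_of_primitive {U u : ℝ → ℂ}
    (h : ∀ x ∈ Ioo (-1 : ℝ) 1, ∀ y ∈ Ioo (-1 : ℝ) 1, IntervalIntegrable u volume x y)
    (hU : ∀ x ∈ Ioo (-1 : ℝ) 1, ∀ y ∈ Ioo (-1 : ℝ) 1, U y - U x = ∫ t in x..y, u t) :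
    ∀ x ∈ Ioo (-1 : ℝ) 1, ∀ y ∈ Ioo (-1 : ℝ) 1, IntervalIntegrable U volume x y := by
  intro x hx y hy
  apply ContinuousOn.intervalIntegrable
  have := (ac_primitive (h x hx y hy)).continuousOn.const_add (U x)
  refine this.congr (fun t ht => ?_)
  have ht' : t ∈ Ioo (-1 : ℝ) 1 := (ordConnected_Ioo.uIcc_subset hx hy) ht
  simp only
  rw [← hU x hx t ht']
  ring

lemma weight_integrable {U V : ℝ → ℂ}
    (hU : IntegrableOn (fun x => ‖U x‖ ^ 2 * (1 - x ^ 2)⁻¹) (Ioo (-1 : ℝ) 1))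
    (hV : IntegrableOn (fun x => ‖V x‖ ^ 2 * (1 - x ^ 2)⁻¹) (Ioo (-1 : ℝ) 1))
    (mU : AEStronglyMeasurable U (volume.restrict (Ioo (-1 : ℝ) 1)))
    (mV : AEStronglyMeasurable V (volume.restrict (Ioo (-1 : ℝ) 1))) :
    IntegrableOn (fun x => U x * star (V x) * ((1 - x ^ 2 : ℝ) : ℂ)⁻¹) (Ioo (-1 : ℝ) 1) := by
  refine Integrable.mono' (hU.add hV) ((mU.mul mV.star).mul
    (Measurable.aestronglyMeasurable (by fun_prop))) ?_
  filter_upwards [ae_restrict_mem measurableSet_Ioo] with x hx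
  have hw : 0 < 1 - x ^ 2 := by nlinarith [hx.1, hx.2]
  rw [norm_mul, norm_mul, norm_star, norm_inv, Complex.norm_real, Real.norm_of_nonneg hw.le]
  simp only [Pi.add_apply]
  rw [← add_mul]
  refine mul_le_mul_of_nonneg_right ?_ (inv_nonneg.2 hw.le)
  nlinarith [sq_nonneg (‖U x‖ - ‖V x‖), sq_nonneg (‖U x‖), sq_nonneg (‖V x‖)]

lemma deriv_integrable {k : ℝ} {f f' f'' g g' g'' : ℝ → ℂ}
    (hf : InJacobiMaxDomain k f f' f'') (hg : InJacobiMaxDomain k g g' g'') :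
    IntegrableOn (fun x => f' x * star (g' x)) (Ioo (-1 : ℝ) 1) := by
  obtain ⟨C, hC, hb⟩ := bounds hf
  obtain ⟨D, hD, hd⟩ := bounds hg
  refine Integrable.mono' (pow_integrableOn.const_mul (C * D))
    ((meas_of_loc hf.1).mul (meas_of_loc hg.1).star) ?_
  filter_upwards [ae_restrict_mem measurableSet_Ioo] with x hx
  have hab : |x| < 1 := abs_lt.2 hx
  have e : (1 - |x|) ^ (-(1 / 2) : ℝ) =
      (1 - |x|) ^ (-(1 / 4) : ℝ) * (1 - |x|) ^ (-(1 / 4) : ℝ) := by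
    rw [← Real.rpow_add (by linarith)]; norm_num
  rw [norm_mul, norm_star, e]
  calc ‖f' x‖ * ‖g' x‖ ≤ (C * (1 - |x|) ^ (-(1 / 4) : ℝ)) * (D * (1 - |x|) ^ (-(1 / 4) : ℝ)) :=
        mul_le_mul (hb x hx).1 (hd x hx).1 (norm_nonneg _)
          (mul_nonneg hC (Real.rpow_nonneg (by linarith) _))
    _ = _ := by ring

lemma boundary {k : ℝ} {f f' f'' g g' g'' : ℝ → ℂ}
    (hf : InJacobiMaxDomain k f f' f'') (hg : InJacobiMaxDomain k g g' g'') (y : ℕ → ℝ)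
    (hy : ∀ n, |y n| = exhSeq n) :
    Tendsto (fun n => f' (y n) * star (g (y n))) atTop (𝓝 0) := by
  obtain ⟨C, hC, hb⟩ := bounds hf
  obtain ⟨D, hD, hd⟩ := bounds hg
  have hlim : Tendsto (fun n => (C * D) * (1 - exhSeq n) ^ (1 / 2 : ℝ)) atTop (𝓝 0) := by
    have h1 : Tendsto (fun n => 1 - exhSeq n) atTop (𝓝 0) := by
      simpa using exhSeq_tendsto.const_sub 1
    have h2 := (h1.rpow_const (p := (1 / 2 : ℝ)) (Or.inr (by norm_num))).const_mul (C * D)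
    simpa using h2
  refine squeeze_zero_norm (fun n => ?_) hlim
  obtain ⟨h0, h1⟩ := exhSeq_mem n
  have hx : y n ∈ Ioo (-1 : ℝ) 1 := abs_lt.1 (by rw [hy]; exact h1)
  have b1 := (hb _ hx).1
  have b2 := (hd _ hx).2
  rw [hy] at b1 b2
  have e : (1 - exhSeq n) ^ (1 / 2 : ℝ) =
      (1 - exhSeq n) ^ (-(1 / 4) : ℝ) * (1 - exhSeq n) ^ (3 / 4 : ℝ) := by
    rw [← Real.rpow_add (by linarith)]; norm_num
  rw [norm_mul, norm_star, e]
  calc _ ≤ (C * (1 - exhSeq n) ^ (-(1 / 4) : ℝ)) * (D * (1 - exhSeq n) ^ (3 / 4 : ℝ)) :=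
        mul_le_mul b1 b2 (norm_nonneg _)
          (mul_nonneg hC (Real.rpow_nonneg (by linarith) _))
    _ = _ := by ring

lemma dirichlet {k : ℝ} {f f' f'' g g' g'' : ℝ → ℂ}
    (hf : InJacobiMaxDomain k f f' f'') (hg : InJacobiMaxDomain k g g' g'') :
    IntegrableOn (fun x => (k : ℂ) * ((1 - x ^ 2 : ℝ) : ℂ)⁻¹ * f x * star (g x))
      (Ioo (-1 : ℝ) 1) ∧
    ∫ x in Ioo (-1 : ℝ) 1,
        (-((1 - x ^ 2 : ℝ) : ℂ) * f'' x + (k : ℂ) * f x) * star (g x) *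
          ((1 - x ^ 2 : ℝ) : ℂ)⁻¹ =
      ∫ x in Ioo (-1 : ℝ) 1,
        (f' x * star (g' x) + (k : ℂ) * ((1 - x ^ 2 : ℝ) : ℂ)⁻¹ * f x * star (g x)) := by
  have hQ := deriv_integrable hf hg
  have hbd := boundary hf hg
  obtain ⟨f1, f2, f3, f4, f5, f6⟩ := hf
  obtain ⟨g1, g2, g3, g4, g5, g6⟩ := hg
  have mf := meas_of_loc (loc_of_primitive f1 f3)
  have mg := meas_of_loc (loc_of_primitive g1 g3)
  have mf2 := meas_of_loc f2
  have hF := weight_integrable f6 g5 (((Measurable.aestronglyMeasurable (by fun_prop)).mul mf2).add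
    (mf.const_mul _)) mg
  have hK : IntegrableOn (fun x => (k : ℂ) * ((1 - x ^ 2 : ℝ) : ℂ)⁻¹ * f x * star (g x))
      (Ioo (-1 : ℝ) 1) := by
    refine ((weight_integrable f5 g5 mf mg).const_mul (k : ℂ)).congr ?_
    filter_upwards with x
    ring
  refine ⟨hK, ?_⟩
  have hsplit := integral_sub hF (hQ.add hK)
  simp only [Pi.add_apply] at hsplit
  rw [← sub_eq_zero, ← hsplit]
  have hlim := exhSeq_cover.integral_tendsto_of_countably_generated (hF.sub (hQ.add hK))
  refine tendsto_nhds_unique hlim ?_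
  have hb1 := hbd exhSeq (fun n => abs_of_nonneg (exhSeq_mem n).1)
  have hb2 := hbd (fun n => -exhSeq n) (fun n => by rw [abs_neg]; exact abs_of_nonneg (exhSeq_mem n).1)
  have hb3 := (hb1.sub hb2).neg
  rw [sub_zero, neg_zero] at hb3
  refine hb3.congr (fun n => ?_)
  obtain ⟨h0, h1⟩ := exhSeq_mem n
  have m1 : -exhSeq n ∈ Ioo (-1 : ℝ) 1 := ⟨by linarith, by linarith⟩
  have m2 : exhSeq n ∈ Ioo (-1 : ℝ) 1 := ⟨by linarith, h1⟩
  have hle : -exhSeq n ≤ exhSeq n := by linarith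
  have hsub : uIcc (-exhSeq n) (exhSeq n) ⊆ Ioo (-1 : ℝ) 1 := ordConnected_Ioo.uIcc_subset m1 m2
  have hsub' : Ioc (-exhSeq n) (exhSeq n) ⊆ Ioo (-1 : ℝ) 1 := fun t ht => hsub (by
    rw [uIcc_of_le hle]; exact Ioc_subset_Icc_self ht)
  have hvI : IntervalIntegrable (fun x => star (g' x)) volume (-exhSeq n) (exhSeq n) := by
    have := g1 _ m1 _ m2
    rw [intervalIntegrable_iff] at this ⊢
    exact Integrable.mono' this.norm this.aestronglyMeasurable.star (by
      filter_upwards with x using by simp)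
  have hI := ibp (U := f') (V := fun x => star (g x)) (f2 _ m1 _ m2) hvI
    (fun x hx => f4 _ m1 x (hsub hx))
    (fun x hx => by
      have e := intervalIntegral.intervalIntegral_conj (f := g') (μ := volume) (a := -exhSeq n) (b := x)
      rw [← g3 _ m1 x (hsub hx), map_sub] at e
      exact e.symm)
  rw [← hI, intervalIntegral.integral_of_le hle, Measure.restrict_restrict measurableSet_Ioc,
    inter_eq_self_of_subset_left hsub', ← integral_neg]
  refine setIntegral_congr_fun measurableSet_Ioc (fun x hx => ?_)
  have hx' := hsub' hx
  have hw : ((1 - x ^ 2 : ℝ) : ℂ) ≠ 0 := by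
    have : 0 < 1 - x ^ 2 := by nlinarith [hx'.1, hx'.2]
    exact_mod_cast this.ne'
  simp only [Pi.add_apply, Pi.sub_apply]
  field_simp
  ring

/-- Dirichlet's formula with vanishing boundary terms: for all `f, g` in the maximal
domain `Δ`, `∫ ℓ[f]·conj(g)·(1-x²)⁻¹ = ∫ [f'·conj(g') + k(1-x²)⁻¹ f·conj(g)]`.
In particular `∫ ℓ[f]·conj(f)·(1-x²)⁻¹ ≥ k·∫|f|²(1-x²)⁻¹`, i.e. the maximal operator
is bounded below by `k` times the identity. -/
theorem dirichlet_formula_bounded_below (k : ℝ) (hk : 0 ≤ k)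
    (f f' f'' g g' g'' : ℝ → ℂ)
    (hf : InJacobiMaxDomain k f f' f'') (hg : InJacobiMaxDomain k g g' g'') :
    (∫ x in Ioo (-1 : ℝ) 1,
        (-((1 - x ^ 2 : ℝ) : ℂ) * f'' x + (k : ℂ) * f x) * star (g x) *
          ((1 - x ^ 2 : ℝ) : ℂ)⁻¹ =
      ∫ x in Ioo (-1 : ℝ) 1,
        (f' x * star (g' x) + (k : ℂ) * ((1 - x ^ 2 : ℝ) : ℂ)⁻¹ * f x * star (g x))) ∧
    k * ∫ x in Ioo (-1 : ℝ) 1, ‖f x‖ ^ 2 * (1 - x ^ 2)⁻¹ ≤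
      (∫ x in Ioo (-1 : ℝ) 1,
        (-((1 - x ^ 2 : ℝ) : ℂ) * f'' x + (k : ℂ) * f x) * star (f x) *
          ((1 - x ^ 2 : ℝ) : ℂ)⁻¹).re := by

  refine ⟨(dirichlet hf hg).2, ?_⟩
  obtain ⟨hK, hE⟩ := dirichlet hf hf
  have hQ := deriv_integrable hf hf
  rw [hE]
  have hre := integral_re (hQ.add hK)
  simp only [Pi.add_apply, RCLike.re_to_complex] at hre
  rw [← hre, ← integral_const_mul]
  refine setIntegral_mono_on (hf.2.2.2.2.1.const_mul k) (hQ.add hK).re measurableSet_Ioo ?_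
  intro x hx
  have e1 : f' x * star (f' x) = ((‖f' x‖ ^ 2 : ℝ) : ℂ) := by
    have := Complex.mul_conj' (f' x)
    push_cast; exact this
  have e2 : (k : ℂ) * ((1 - x ^ 2 : ℝ) : ℂ)⁻¹ * f x * star (f x) =
      ((k * (‖f x‖ ^ 2 * (1 - x ^ 2)⁻¹) : ℝ) : ℂ) := by
    have : f x * star (f x) = (‖f x‖ : ℂ) ^ 2 := Complex.mul_conj' (f x)
    rw [mul_assoc, this]
    push_cast; ring
  rw [e1, e2, ← Complex.ofReal_add, Complex.ofReal_re]
  linarith [sq_nonneg ‖f' x‖]
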